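/- Let (G,ρ) be a group with a two-sided invariant metric ρ, complete with respect to ρ, let c : Γ × ∂Γ → G be a Hölder continuous cocycle satisfying c(g,g⁺) = c(g,g⁻) = e for every infinite order element g ∈ Γ, let g ∈ Γ be of infinite order, and let b_g(ξ) = lim_n c(g⁻ⁿ,ξ) for ξ ∈ ∂Γ∖{g⁻} (this limit exists). Then: (1) for every h ∈ Γ with h·g⁺ ≠ g⁻ one has b_g(h·g⁺) = c(h⁻¹,g⁺)⁻¹; and (2) for every k ∈ Γ and every ξ ∈ ∂Γ∖{g⁻, k·g⁻} one has b_g(ξ) = b_{kgk⁻¹}(ξ)·c(k⁻¹,g⁺)⁻¹. -/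

import Mathlib

open Filter Topology MeasureTheory
open scoped ENNReal

namespace HarmonicBoundary

variable {Γ : Type} [Group Γ]

/-- Word length of `g` with respect to a generating set `S`. -/
noncomputable def wl (S : Set Γ) (g : Γ) : ℕ :=
  sInf {n : ℕ | ∃ w : List Γ, w.length = n ∧ (∀ x ∈ w, x ∈ S) ∧ w.prod = g}

/-- Word metric `d(x,y) = |x⁻¹y|`. -/
noncomputable def wdist (S : Set Γ) (x y : Γ) : ℕ := wl S (x⁻¹ * y)

/-- Gromov product `(x|y)_z = (d(x,z)+d(y,z)-d(x,y))/2`. -/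
noncomputable def gp (S : Set Γ) (z x y : Γ) : ℝ :=
  ((wdist S x z : ℝ) + (wdist S y z : ℝ) - (wdist S x y : ℝ)) / 2

/-- `S` is a finite symmetric generating set of `Γ`. -/
def IsGenSet (S : Set Γ) : Prop :=
  S.Finite ∧ (∀ s ∈ S, s⁻¹ ∈ S) ∧ Subgroup.closure S = ⊤

/-- `Γ` is `δ`-hyperbolic with respect to the word metric of `S`:
`(x|y) ≥ min ((x|z), (y|z)) - δ` for all `x y z`. -/
def IsHyperbolic (S : Set Γ) (δ : ℝ) : Prop :=
  0 ≤ δ ∧ ∀ x y z : Γ, min (gp S 1 x z) (gp S 1 y z) - δ ≤ gp S 1 x y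

/-- `Γ` is nonelementary: it has no cyclic subgroup of finite index. -/
def Nonelementary (Γ : Type) [Group Γ] : Prop :=
  ∀ g : Γ, (Subgroup.zpowers g).index = 0

/-- A sequence converges to infinity if `(x_i|x_j) → ∞`. -/
def ConvInf (S : Set Γ) (u : ℕ → Γ) : Prop :=
  Tendsto (fun p : ℕ × ℕ => gp S 1 (u p.1) (u p.2)) atTop atTop

/-- Two sequences converging to infinity are equivalent if `(x_i|y_j) → ∞`. -/
def EquivSeq (S : Set Γ) (u v : ℕ → Γ) : Prop :=
  Tendsto (fun p : ℕ × ℕ => gp S 1 (u p.1) (v p.2)) atTop atTop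

/-- An (abstract model of the) Gromov boundary of `Γ`: the points are exactly the
classes of sequences converging to infinity, modulo the equivalence `EquivSeq`,
together with the natural left action of `Γ`. -/
structure Boundary (Γ : Type) [Group Γ] (S : Set Γ) where
  pt : Type
  cls : (ℕ → Γ) → pt
  cls_surj : ∀ ξ : pt, ∃ u : ℕ → Γ, ConvInf S u ∧ cls u = ξ
  cls_eq : ∀ u v : ℕ → Γ, ConvInf S u → ConvInf S v → (cls u = cls v ↔ EquivSeq S u v)
  smul : Γ → pt → pt
  smul_cls : ∀ (g : Γ) (u : ℕ → Γ), ConvInf S u → smul g (cls u) = cls fun n => g * u n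

/-- Extension of the Gromov product to the boundary:
`(ξ|η) = sup liminf (x_i|y_j)` over sequences representing `ξ` and `η`,
as an extended nonnegative real. -/
noncomputable def bgp {S : Set Γ} (B : Boundary Γ S) (ξ η : B.pt) : ℝ≥0∞ :=
  ⨆ (u : {u : ℕ → Γ // ConvInf S u ∧ B.cls u = ξ})
    (v : {v : ℕ → Γ // ConvInf S v ∧ B.cls v = η}),
    Filter.liminf (fun p : ℕ × ℕ => ENNReal.ofReal (gp S 1 (u.1 p.1) (v.1 p.2))) atTop

/-- Real-valued Gromov product on the boundary (finite for `ξ ≠ η`). -/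
noncomputable def bgpR {S : Set Γ} (B : Boundary Γ S) (ξ η : B.pt) : ℝ := (bgp B ξ η).toReal

/-- The canonical topology of the Gromov boundary: a set is open iff around each of
its points it contains a basic neighbourhood `V_r(p) = {q | (q|p) > r}`. -/
def btop {S : Set Γ} (B : Boundary Γ S) : TopologicalSpace B.pt where
  IsOpen O := ∀ p ∈ O, ∃ r : ℝ≥0∞, r ≠ ⊤ ∧ {q | r < bgp B q p} ⊆ O
  isOpen_univ := fun p _ => ⟨0, ENNReal.zero_ne_top, fun q _ => trivial⟩
  isOpen_inter := by
    intro A A' hA hA' p hp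
    obtain ⟨r1, hr1, h1⟩ := hA p hp.1
    obtain ⟨r2, hr2, h2⟩ := hA' p hp.2
    refine ⟨max r1 r2, (max_lt hr1.lt_top hr2.lt_top).ne, fun q hq => ?_⟩
    have hq' : max r1 r2 < bgp B q p := hq
    exact ⟨h1 (show r1 < bgp B q p from (le_max_left r1 r2).trans_lt hq'),
      h2 (show r2 < bgp B q p from (le_max_right r1 r2).trans_lt hq')⟩
  isOpen_sUnion := by
    intro s hs p hp
    obtain ⟨t, ht, hpt⟩ := hp
    obtain ⟨r, hr, hsub⟩ := hs t ht p hpt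
    exact ⟨r, hr, fun q hq => ⟨t, ht, hsub hq⟩⟩

/-- The attracting fixed point `g⁺ = lim_n gⁿ` of an (infinite order) element. -/
def plusPt {S : Set Γ} (B : Boundary Γ S) (g : Γ) : B.pt := B.cls fun n => g ^ n

/-- The repelling fixed point `g⁻ = lim_n g⁻ⁿ` of an (infinite order) element. -/
def minusPt {S : Set Γ} (B : Boundary Γ S) (g : Γ) : B.pt := B.cls fun n => g⁻¹ ^ n

/-- A geodesic ray starting at the identity. -/
def IsGeodesicRay (S : Set Γ) (x : ℕ → Γ) : Prop :=
  x 0 = 1 ∧ ∀ m n : ℕ, wdist S (x m) (x n) = Nat.dist m n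

/-- A geodesic ray from `e` to the boundary point `ξ`, i.e. an element of `[e,ξ]`. -/
def RayTo {S : Set Γ} (B : Boundary Γ S) (x : ℕ → Γ) (ξ : B.pt) : Prop :=
  IsGeodesicRay S x ∧ ConvInf S x ∧ B.cls x = ξ

/-- A geodesic segment from `x` to `y` (parametrized on `0,…,d(x,y)`),
i.e. an element of `[x,y]`. -/
def IsGeodesicSeg (S : Set Γ) (x y : Γ) (α : ℕ → Γ) : Prop :=
  α 0 = x ∧ α (wdist S x y) = y ∧
  ∀ m n : ℕ, m ≤ wdist S x y → n ≤ wdist S x y → wdist S (α m) (α n) = Nat.dist m n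

/-- The boundary "cylinder" `U(ξ,R)`: all `η` such that for every pair of geodesic
rays `x ∈ [e,ξ]`, `y ∈ [e,η]` one has `lim_n (x(n)|y(n)) > R` (the sequence
`(x(n)|y(n))` is nondecreasing, so the limit exceeds `R` iff some term does). -/
def Uset {S : Set Γ} (B : Boundary Γ S) (ξ : B.pt) (R : ℝ) : Set B.pt :=
  {η | ∀ x y : ℕ → Γ, RayTo B x ξ → RayTo B y η → ∃ n : ℕ, R < gp S 1 (x n) (y n)}

/-- `C_r(p) = {g | (g|e)_p > r}`. -/
def Cset (S : Set Γ) (p : Γ) (r : ℝ) : Set Γ := {g | r < gp S p g 1}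

/-- The `R`-neighbourhood `N(α,R)` of a geodesic segment `α ∈ [x,y]`. -/
def segN (S : Set Γ) (x y : Γ) (α : ℕ → Γ) (R : ℝ) : Set Γ :=
  {g | ∃ i ≤ wdist S x y, (wdist S g (α i) : ℝ) ≤ R}

/-- The `R`-neighbourhood `N(A,R)` of a subset `A ⊆ Γ`. -/
def setN (S : Set Γ) (A : Set Γ) (R : ℝ) : Set Γ :=
  {g | ∃ a ∈ A, (wdist S g a : ℝ) ≤ R}

/-- `μ` is a nondegenerate probability measure on `Γ` with support contained in `S`:
nonnegative, of total mass one, supported in `S`, and the semigroup generated by its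
support is the whole of `Γ`. -/
structure IsRWMeasure (S : Set Γ) (μ : Γ → ℝ) : Prop where
  nonneg : ∀ g, 0 ≤ μ g
  support_subset : ∀ g, μ g ≠ 0 → g ∈ S
  total : ∑' g : Γ, μ g = 1
  nondeg : ∀ g : Γ, ∃ l : List Γ, l ≠ [] ∧ (∀ x ∈ l, 0 < μ x) ∧ l.prod = g

open Classical in
/-- `n`-step transition probabilities `p⁽ⁿ⁾(x,y) = μ*ⁿ(x⁻¹y)` of the random walk. -/
noncomputable def ptrans (μ : Γ → ℝ) : ℕ → Γ → Γ → ℝ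
  | 0 => fun x y => if x = y then 1 else 0
  | n + 1 => fun x y => ∑' z : Γ, ptrans μ n x z * μ (z⁻¹ * y)

/-- Green function `G(x,y) = Σ_n p⁽ⁿ⁾(x,y)`. -/
noncomputable def green (μ : Γ → ℝ) (x y : Γ) : ℝ := ∑' n : ℕ, ptrans μ n x y

/-- `F(x,y) = G(x,y)/G(y,y)`, the probability that the walk from `x` ever hits `y`. -/
noncomputable def greenF (μ : Γ → ℝ) (x y : Γ) : ℝ := green μ x y / green μ y y

/-- The Martin kernel `K(x,y) = G(x,y)/G(e,y)`. -/
noncomputable def martinK (μ : Γ → ℝ) (x y : Γ) : ℝ := green μ x y / green μ 1 y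

open Classical in
/-- Transition probabilities of the walk restricted to `Δ` (killed when leaving `Δ`). -/
noncomputable def ptransR (μ : Γ → ℝ) (Δ : Set Γ) : ℕ → Γ → Γ → ℝ
  | 0 => fun x y => if x = y ∧ x ∈ Δ then 1 else 0
  | n + 1 => fun x y => if y ∈ Δ then ∑' z : Γ, ptransR μ Δ n x z * μ (z⁻¹ * y) else 0

/-- Green function `G_Δ` of the restricted walk. -/
noncomputable def greenR (μ : Γ → ℝ) (Δ : Set Γ) (x y : Γ) : ℝ := ∑' n : ℕ, ptransR μ Δ n x y

/-- `F_Δ(x,y) = G_Δ(x,y)/G_Δ(y,y)`. -/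
noncomputable def greenFR (μ : Γ → ℝ) (Δ : Set Γ) (x y : Γ) : ℝ :=
  greenR μ Δ x y / greenR μ Δ y y

/-- Generating function `G_Δ(x,y|z) = Σ_n p_Δ⁽ⁿ⁾(x,y) zⁿ`. -/
noncomputable def greenRZ (μ : Γ → ℝ) (Δ : Set Γ) (x y : Γ) (z : ℝ) : ℝ :=
  ∑' n : ℕ, ptransR μ Δ n x y * z ^ n

/-- Spectral radius `ρ(P) = lim_n p⁽ⁿ⁾(e,e)^{1/n}` of the walk. -/
noncomputable def specRad (μ : Γ → ℝ) : ℝ :=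
  Filter.limsup (fun n : ℕ => (ptrans μ n 1 1) ^ ((n : ℝ)⁻¹)) atTop

/-- `u` is harmonic on `Λ`: `Σ_h p(g,h) u(h) = u(g)` for `g ∈ Λ`, `p(g,h)=μ(g⁻¹h)`. -/
def HarmonicOn (μ : Γ → ℝ) (u : Γ → ℝ) (Λ : Set Γ) : Prop :=
  ∀ g ∈ Λ, (∑' h : Γ, μ (g⁻¹ * h) * u h) = u g

/-- `u` vanishes at infinity on `Λ`: `u(g_n) → 0` along sequences in `Λ` with `|g_n|→∞`. -/
def VanishesAtInftyOn (S : Set Γ) (u : Γ → ℝ) (Λ : Set Γ) : Prop :=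
  ∀ ε : ℝ, 0 < ε → ∃ M : ℕ, ∀ g ∈ Λ, M ≤ wl S g → |u g| ≤ ε

open Classical in
/-- `r(g) = K(g⁻¹,g⁺)` for infinite order `g`, and `r(g) = 1` for finite order `g`;
here `Kb` is the boundary extension of the Martin kernel. -/
noncomputable def rfun {S : Set Γ} (B : Boundary Γ S) (Kb : Γ → B.pt → ℝ) (g : Γ) : ℝ :=
  if IsOfFinOrder g then 1 else Kb g⁻¹ (plusPt B g)

/-- The ratio set `r(Γ,∂Γ,ν)`: all `l ≥ 0` such that for every `ε > 0` and every
Borel `A` of positive measure there is `g ∈ Γ` such that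
`{ω ∈ gA ∩ A : |d(gν)/dν(ω) − l| < ε}` has positive measure; here the
Radon–Nikodym derivative `d(gν)/dν` is the Martin kernel `Kb g`. -/
def ratioSet {S : Set Γ} (B : Boundary Γ S) [MeasurableSpace B.pt]
    (ν : Measure B.pt) (Kb : Γ → B.pt → ℝ) : Set ℝ :=
  {l : ℝ | 0 ≤ l ∧ ∀ ε : ℝ, 0 < ε → ∀ A : Set B.pt, MeasurableSet A → 0 < ν A →
    ∃ g : Γ, 0 < ν {ω | ω ∈ A ∧ B.smul g⁻¹ ω ∈ A ∧ |Kb g ω - l| < ε}}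

/-- A left invariant finitely additive mean on `Γ`; `Γ` is amenable iff one exists. -/
structure InvariantMean (Γ : Type) [Group Γ] where
  m : Set Γ → ℝ
  nonneg : ∀ A, 0 ≤ m A
  total : m Set.univ = 1
  fin_add : ∀ A B : Set Γ, Disjoint A B → m (A ∪ B) = m A + m B
  invariant : ∀ (g : Γ) (A : Set Γ), m ((g * ·) ⁻¹' A) = m A


/-! ### Word length basics -/

/-- Word length, as a real number. -/
noncomputable def len (S : Set Γ) (x : Γ) : ℝ := (wl S x : ℝ)

/-- Word metric, as a real number. -/
noncomputable def dd (S : Set Γ) (x y : Γ) : ℝ := (wdist S x y : ℝ)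

lemma dd_eq (S : Set Γ) (x y : Γ) : dd S x y = len S (x⁻¹ * y) := rfl

lemma exists_word {S : Set Γ} (hS : IsGenSet S) (g : Γ) :
    ∃ w : List Γ, (∀ x ∈ w, x ∈ S) ∧ w.prod = g := by
  have hg : g ∈ Subgroup.closure S := by rw [hS.2.2]; trivial
  rw [← Subgroup.mem_toSubmonoid, Subgroup.closure_toSubmonoid] at hg
  obtain ⟨l, hl, hp⟩ := Submonoid.exists_list_of_mem_closure hg
  refine ⟨l, fun x hx => ?_, hp⟩
  rcases hl x hx with h | h
  · exact h
  · simpa using hS.2.1 _ h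

lemma exists_min_word {S : Set Γ} (hS : IsGenSet S) (g : Γ) :
    ∃ w : List Γ, w.length = wl S g ∧ (∀ x ∈ w, x ∈ S) ∧ w.prod = g := by
  have hne : {n : ℕ | ∃ w : List Γ, w.length = n ∧ (∀ x ∈ w, x ∈ S) ∧ w.prod = g}.Nonempty := by
    obtain ⟨w, h1, h2⟩ := exists_word hS g
    exact ⟨w.length, w, rfl, h1, h2⟩
  exact Nat.sInf_mem hne

lemma wl_le {S : Set Γ} (w : List Γ) (hw : ∀ x ∈ w, x ∈ S) : wl S w.prod ≤ w.length :=
  Nat.sInf_le ⟨w, rfl, hw, rfl⟩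

lemma wl_mul {S : Set Γ} (hS : IsGenSet S) (x y : Γ) : wl S (x * y) ≤ wl S x + wl S y := by
  obtain ⟨w, h1, h2, h3⟩ := exists_min_word hS x
  obtain ⟨v, k1, k2, k3⟩ := exists_min_word hS y
  have := wl_le (S := S) (w ++ v) (by
    intro z hz
    rcases List.mem_append.1 hz with h | h
    · exact h2 z h
    · exact k2 z h)
  rw [List.prod_append, h3, k3, List.length_append, h1, k1] at this
  exact this

lemma wl_one (S : Set Γ) : wl S (1 : Γ) = 0 := by
  have := wl_le (S := S) ([] : List Γ) (by simp)
  simpa using this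

lemma wl_inv_le {S : Set Γ} (hS : IsGenSet S) (x : Γ) : wl S x⁻¹ ≤ wl S x := by
  obtain ⟨w, h1, h2, h3⟩ := exists_min_word hS x
  have := wl_le (S := S) (w.map (fun x => x⁻¹)).reverse (by
    intro z hz
    simp only [List.mem_reverse, List.mem_map] at hz
    obtain ⟨a, ha, rfl⟩ := hz
    exact hS.2.1 _ (h2 a ha))
  rw [← List.prod_inv_reverse, h3] at this
  simpa [h1] using this

lemma wl_inv {S : Set Γ} (hS : IsGenSet S) (x : Γ) : wl S x⁻¹ = wl S x :=
  le_antisymm (wl_inv_le hS x) (by simpa using wl_inv_le hS x⁻¹)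

lemma exists_split {S : Set Γ} (hS : IsGenSet S) (g : Γ) (n : ℕ) (hn : n ≤ wl S g) :
    ∃ x : Γ, wl S x = n ∧ wl S (x⁻¹ * g) = wl S g - n := by
  obtain ⟨w, h1, h2, h3⟩ := exists_min_word hS g
  have e : (w.take n).prod * (w.drop n).prod = g := by
    rw [← List.prod_append, List.take_append_drop, h3]
  have a1 := wl_le (S := S) (w.take n) (fun x hx => h2 x (List.mem_of_mem_take hx))
  have a2 := wl_le (S := S) (w.drop n) (fun x hx => h2 x (List.mem_of_mem_drop hx))
  have a3 := wl_mul hS (w.take n).prod (w.drop n).prod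
  rw [e] at a3
  simp only [List.length_take, List.length_drop] at a1 a2
  have e2 : (w.take n).prod⁻¹ * g = (w.drop n).prod := by rw [← e]; group
  refine ⟨(w.take n).prod, by omega, ?_⟩
  rw [e2]; omega

lemma ball_finite {S : Set Γ} (hS : IsGenSet S) (n : ℕ) : {x : Γ | wl S x ≤ n}.Finite := by
  have : {x : Γ | wl S x ≤ n} ⊆
      List.prod '' {l : List Γ | l.length ≤ n ∧ ∀ x ∈ l, x ∈ S} := by
    intro x hx
    obtain ⟨w, h1, h2, h3⟩ := exists_min_word hS x
    exact ⟨w, ⟨h1.le.trans hx, h2⟩, h3⟩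
  refine Set.Finite.subset (Set.Finite.image _ ?_) this
  induction n with
  | zero =>
    refine (Set.finite_singleton ([] : List Γ)).subset ?_
    rintro l ⟨h, -⟩
    simpa using h
  | succ n ih =>
    have hfin := (hS.1.image2 List.cons (ih (by
      intro x hx
      obtain ⟨w, h1, h2, h3⟩ := exists_min_word hS x
      exact ⟨w, ⟨h1.le.trans hx, h2⟩, h3⟩))).union (Set.finite_singleton ([] : List Γ))
    refine hfin.subset ?_
    rintro l ⟨h, h'⟩
    cases l with
    | nil => right; rfl
    | cons a l =>
      left
      refine ⟨a, h' a (by simp), l, ⟨by simpa using h, fun x hx => h' x (by simp [hx])⟩, rfl⟩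

lemma ballR_finite {S : Set Γ} (hS : IsGenSet S) (R : ℝ) : {x : Γ | len S x ≤ R}.Finite := by
  refine (ball_finite hS ⌈R⌉₊).subset ?_
  intro x hx
  have h1 : (wl S x : ℝ) ≤ R := hx
  have h2 := Nat.le_ceil R
  have : (wl S x : ℝ) ≤ (⌈R⌉₊ : ℝ) := h1.trans h2
  exact_mod_cast this

lemma len_nonneg (S : Set Γ) (x : Γ) : 0 ≤ len S x := Nat.cast_nonneg _

lemma len_one (S : Set Γ) : len S (1 : Γ) = 0 := by simp [len, wl_one]

lemma len_inv {S : Set Γ} (hS : IsGenSet S) (x : Γ) : len S x⁻¹ = len S x := by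
  simp [len, wl_inv hS]

lemma len_mul {S : Set Γ} (hS : IsGenSet S) (x y : Γ) : len S (x * y) ≤ len S x + len S y := by
  unfold len; exact_mod_cast wl_mul hS x y

lemma dd_nonneg (S : Set Γ) (x y : Γ) : 0 ≤ dd S x y := Nat.cast_nonneg _

lemma dd_self (S : Set Γ) (x : Γ) : dd S x x = 0 := by simp [dd_eq, len_one]

lemma dd_comm {S : Set Γ} (hS : IsGenSet S) (x y : Γ) : dd S x y = dd S y x := by
  rw [dd_eq, dd_eq, ← len_inv hS]; congr 1; group

lemma dd_tri {S : Set Γ} (hS : IsGenSet S) (x y z : Γ) : dd S x z ≤ dd S x y + dd S y z := by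
  rw [dd_eq, dd_eq, dd_eq]
  have := len_mul hS (x⁻¹ * y) (y⁻¹ * z)
  rwa [show x⁻¹ * y * (y⁻¹ * z) = x⁻¹ * z by group] at this

lemma dd_left (S : Set Γ) (k x y : Γ) : dd S (k * x) (k * y) = dd S x y := by
  rw [dd_eq, dd_eq]; congr 1; group

lemma dd_one_left (S : Set Γ) (x : Γ) : dd S 1 x = len S x := by simp [dd_eq]

lemma dd_one_right {S : Set Γ} (hS : IsGenSet S) (x : Γ) : dd S x 1 = len S x := by
  rw [dd_comm hS, dd_one_left]

lemma gp_eq {S : Set Γ} (hS : IsGenSet S) (x y : Γ) :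
    gp S 1 x y = (len S x + len S y - dd S x y) / 2 := by
  rw [← dd_one_right hS x, ← dd_one_right hS y]; rfl

/-- The four point condition. -/
lemma four {S : Set Γ} {δ : ℝ} (hS : IsGenSet S) (hδ : IsHyperbolic S δ) (x y z w : Γ) :
    dd S x y + dd S z w ≤ dd S x z + dd S y w + 2 * δ ∨
    dd S x y + dd S z w ≤ dd S x w + dd S y z + 2 * δ := by
  have h := hδ.2 (w⁻¹ * x) (w⁻¹ * y) (w⁻¹ * z)
  simp only [gp_eq hS, dd_left] at h
  simp only [← dd_eq] at h
  rw [dd_comm hS w x, dd_comm hS w y, dd_comm hS w z] at h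
  rcases le_total ((dd S x w + dd S z w - dd S x z) / 2) ((dd S y w + dd S z w - dd S y z) / 2)
    with h' | h'
  · rw [min_eq_left h'] at h; left; linarith
  · rw [min_eq_right h'] at h; right; linarith

lemma len_pow_le {S : Set Γ} (hS : IsGenSet S) (g : Γ) (n : ℕ) : len S (g ^ n) ≤ n * len S g := by
  induction n with
  | zero => simp [len_one]
  | succ n ih =>
    rw [pow_succ]
    have := len_mul hS (g ^ n) g
    push_cast; linarith

lemma dd_pow (S : Set Γ) (g : Γ) (i j : ℕ) : dd S (g ^ i) (g ^ (i + j)) = len S (g ^ j) := by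
  rw [dd_eq, pow_add]; congr 1; group

/-! ### Loxodromic elements -/

/-- Loxodromic elements: linear growth and almost super-additivity of the lengths of powers. -/
def Lox (S : Set Γ) (g : Γ) : Prop :=
  ∃ a : ℝ, 0 < a ∧ ∃ E : ℝ, (∀ m : ℕ, a * m - E ≤ len S (g ^ m)) ∧
    ∀ i j : ℕ, len S (g ^ i) + len S (g ^ j) ≤ len S (g ^ (i + j)) + E

lemma crit {S : Set Γ} {δ : ℝ} (hS : IsGenSet S) (hδ : IsHyperbolic S δ) (h : Γ)
    (H : len S h + 4 * δ + 1 ≤ len S (h ^ 2)) (n : ℕ) :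
    len S (h ^ n) + 2 * δ + 1 ≤ len S (h ^ (n + 1)) := by
  have hδ0 := hδ.1
  induction n with
  | zero =>
    have := len_mul hS h h
    rw [← pow_two] at this
    simp [len_one]; linarith
  | succ n ih =>
    have key := four hS hδ 1 (h ^ 2) (h ^ 1) (h ^ (1 + (n + 1)))
    have e1 := dd_pow S h 1 1
    have e2 := dd_pow S h 1 (n + 1)
    have e3 := dd_pow S h 2 n
    rw [show 1 + 1 = 2 from rfl, dd_comm hS] at e1
    rw [e1, e2, dd_one_left, dd_one_left, dd_one_left,
      show 1 + (n + 1) = 2 + n by ring, e3, pow_one] at key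
    rw [show n + 1 + 1 = 2 + n by ring]
    rcases key with k | k <;> linarith

lemma lox_of_crit {S : Set Γ} {δ : ℝ} (hS : IsGenSet S) (hδ : IsHyperbolic S δ) (h : Γ)
    (H : len S h + 4 * δ + 1 ≤ len S (h ^ 2)) : Lox S h := by
  have hδ0 := hδ.1
  have C := crit hS hδ h H
  refine ⟨1, one_pos, len S h, fun m => ?_, fun i j => ?_⟩
  · have : (m : ℝ) ≤ len S (h ^ m) := by
      induction m with
      | zero => simp [len_one]
      | succ m ih => have := C m; push_cast; linarith
    have := len_nonneg S h
    linarith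
  · cases i with
    | zero => simp [len_one]; exact len_nonneg S h
    | succ i =>
      have key := four hS hδ 1 (h ^ (i + 1)) (h ^ i) (h ^ (i + (1 + j)))
      have e1 := dd_pow S h i 1
      have e2 := dd_pow S h i (1 + j)
      have e3 := dd_pow S h (i + 1) j
      rw [dd_comm hS] at e1
      rw [e1, e2, dd_one_left, dd_one_left, dd_one_left,
        show i + (1 + j) = i + 1 + j by ring, e3, pow_one] at key
      have c1 := C i
      have c2 := C j
      rw [show 1 + j = j + 1 by ring] at key
      rcases key with k | k <;> linarith

lemma len_conj_le {S : Set Γ} (hS : IsGenSet S) (x g : Γ) :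
    len S (x⁻¹ * g * x) ≤ len S g + 2 * len S x := by
  have h1 := len_mul hS (x⁻¹ * g) x
  have h2 := len_mul hS x⁻¹ g
  rw [len_inv hS] at h2
  linarith

lemma conj_pow' (x g : Γ) (m : ℕ) : (x⁻¹ * g * x) ^ m = x⁻¹ * g ^ m * x := by
  have := conj_pow (i := m) (a := x⁻¹) (b := g)
  simpa using this

lemma lox_conj {S : Set Γ} (hS : IsGenSet S) (x g : Γ) (h : Lox S (x⁻¹ * g * x)) : Lox S g := by
  obtain ⟨a, ha, E, h1, h2⟩ := h
  have up : ∀ m : ℕ, len S ((x⁻¹ * g * x) ^ m) ≤ len S (g ^ m) + 2 * len S x := by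
    intro m; rw [conj_pow']; exact len_conj_le hS _ _
  have dn : ∀ m : ℕ, len S (g ^ m) ≤ len S ((x⁻¹ * g * x) ^ m) + 2 * len S x := by
    intro m; rw [conj_pow']
    have := len_conj_le hS x⁻¹ (x⁻¹ * g ^ m * x)
    rw [len_inv hS] at this
    rwa [show x⁻¹⁻¹ * (x⁻¹ * g ^ m * x) * x⁻¹ = g ^ m by group] at this
  have hx := len_nonneg S x
  refine ⟨a, ha, E + 6 * len S x, fun m => ?_, fun i j => ?_⟩
  · have := h1 m; have := up m; linarith
  · have := h2 i j; have := up (i + j); have := dn i; have := dn j; linarith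

lemma lox_pow {S : Set Γ} (hS : IsGenSet S) (g : Γ) (k : ℕ) (hk : 0 < k) (h : Lox S (g ^ k)) :
    Lox S g := by
  obtain ⟨a, ha, E, h1, h2⟩ := h
  have hk' : (0 : ℝ) < k := by exact_mod_cast hk
  set D : ℝ := ∑ r ∈ Finset.range k, len S (g ^ r) with hD
  have hDr : ∀ r < k, len S (g ^ r) ≤ D := fun r hr =>
    Finset.single_le_sum (f := fun r => len S (g ^ r)) (fun i _ => len_nonneg S _)
      (Finset.mem_range.2 hr)
  have hD0 : 0 ≤ D := Finset.sum_nonneg fun i _ => len_nonneg S _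
  refine ⟨a / k, by positivity, |E| / k + |E| + 4 * D, fun m => ?_, fun i j => ?_⟩
  · have e := len_pow_le hS (g ^ m) k
    have := h1 m
    rw [← pow_mul, mul_comm k m, pow_mul] at this
    have h3 : a * m - |E| ≤ k * len S (g ^ m) := by linarith [le_abs_self E]
    have h4 : (a * m - |E|) / k ≤ len S (g ^ m) := by
      rw [div_le_iff₀ hk']; linarith
    have h5 : (a * m - |E|) / k = a / k * m - |E| / k := by ring
    have := abs_nonneg E
    linarith
  · have q : ∀ i : ℕ, len S (g ^ i) ≤ len S ((g ^ k) ^ (i / k)) + D := by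
      intro i
      have e : g ^ i = (g ^ k) ^ (i / k) * g ^ (i % k) := by
        rw [← pow_mul, ← pow_add, Nat.div_add_mod]
      have := len_mul hS ((g ^ k) ^ (i / k)) (g ^ (i % k))
      rw [← e] at this
      linarith [hDr (i % k) (Nat.mod_lt _ hk)]
    have s : len S ((g ^ k) ^ (i / k + j / k)) ≤ len S (g ^ (i + j)) + 2 * D := by
      have e : (g ^ k) ^ (i / k + j / k) = g ^ (i + j) * ((g ^ (i % k))⁻¹ * (g ^ (j % k))⁻¹) := by
        have e1 : i + j = k * (i / k + j / k) + (j % k + i % k) := by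
          have := Nat.div_add_mod i k
          have := Nat.div_add_mod j k
          rw [mul_add]; omega
        rw [e1, ← pow_mul, pow_add g (k * (i / k + j / k)), pow_add g (j % k)]; group
      rw [e]
      have a1 := len_mul hS (g ^ (i + j)) ((g ^ (i % k))⁻¹ * (g ^ (j % k))⁻¹)
      have a2 := len_mul hS (g ^ (i % k))⁻¹ (g ^ (j % k))⁻¹
      rw [len_inv hS, len_inv hS] at a2
      linarith [hDr (i % k) (Nat.mod_lt _ hk), hDr (j % k) (Nat.mod_lt _ hk)]
    have := q i
    have := q j
    have := h2 (i / k) (j / k)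
    have : 0 ≤ |E| / k := by positivity
    linarith [le_abs_self E]

lemma shift_dichotomy {S : Set Γ} {δ : ℝ} (hS : IsGenSet S) (hδ : IsHyperbolic S δ)
    (y q x : Γ) (D : ℝ) (hxq : len S x + dd S x q = len S q) (hy : len S y ≤ D)
    (hq : dd S q (y * q) ≤ D) (hx : 3 * D + 50 * δ + 50 ≤ len S x)
    (hx' : 3 * D + 50 * δ + 50 ≤ dd S x q) :
    len S (x⁻¹ * y * x) ≤ 18 * δ + 1 ∨
      len S (x⁻¹ * y * x) + 4 * δ + 1 ≤ len S ((x⁻¹ * y * x) ^ 2) := by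
  have hδ0 := hδ.1
  have hD0 : 0 ≤ D := (len_nonneg S y).trans hy
  have l1 : len S (x⁻¹ * y * x) = dd S x (y * x) := by rw [dd_eq]; congr 1; group
  have l2 : len S ((x⁻¹ * y * x) ^ 2) = dd S x (y * (y * x)) := by
    rw [conj_pow', dd_eq, pow_two]; congr 1; group
  rw [l1, l2]
  have p1 : dd S 1 y ≤ D := by rwa [dd_one_left]
  rw [← dd_one_left S x, ← dd_one_left S q] at hxq
  rw [← dd_one_left S x] at hx
  have m1 : dd S y (y * x) = dd S 1 x := by simpa using dd_left S y 1 x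
  have m2 : dd S (y * x) (y * q) = dd S x q := dd_left S y x q
  have m3 : dd S (y * x) (y * (y * x)) = dd S x (y * x) := dd_left S y _ _
  have m4 : dd S y (y * q) = dd S 1 q := by simpa using dd_left S y 1 q
  have m5 : dd S y (y * (y * x)) = dd S 1 (y * x) := by simpa using dd_left S y 1 (y * x)
  have t1 := dd_tri hS 1 y (y * x)
  have t2 := dd_tri hS y 1 (y * x)
  rw [dd_comm hS y 1] at t2
  have t3 := dd_tri hS 1 x (y * (y * x))
  have t4 := dd_tri hS 1 (y * (y * x)) x
  rw [dd_comm hS (y * (y * x)) x] at t4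
  have f1 := four hS hδ y (y * q) 1 (y * x)
  have f2 := four hS hδ 1 (y * q) q (y * x)
  have f3 := four hS hδ 1 q x (y * x)
  have f4 := four hS hδ 1 (y * (y * x)) y (y * x)
  have f5 := four hS hδ 1 (y * x) y (y * (y * x))
  rw [dd_comm hS y 1, dd_comm hS (y * q) (y * x), dd_comm hS (y * q) 1] at f1
  rw [dd_comm hS (y * q) (y * x), dd_comm hS (y * q) q] at f2
  rw [dd_comm hS q x] at f3
  rw [dd_comm hS (y * (y * x)) y, dd_comm hS (y * (y * x)) (y * x)] at f4
  rw [dd_comm hS (y * x) y] at f5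
  rw [m1, m2, m4] at f1
  rw [m2] at f2
  rw [m1, m3, m5] at f4
  rw [m1, m3, m5] at f5
  rw [m1] at t1 t2
  have g1 : dd S 1 (y * x) + dd S x q ≤ dd S 1 (y * q) + 2 * δ := by
    rcases f1 with f | f <;> linarith [dd_nonneg S 1 (y * x)]
  have g2 : dd S 1 (y * x) + dd S q (y * x) ≤ dd S 1 q + 4 * δ := by
    rcases f2 with f | f <;> linarith [dd_nonneg S q (y * x)]
  by_cases hs : dd S x (y * x) ≤ 18 * δ + 1
  · exact Or.inl hs
  right
  push Not at hs
  have sD : dd S x (y * x) ≤ D + 6 * δ := by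
    rcases f3 with f | f <;> linarith
  have g4 : dd S 1 (y * (y * x)) + dd S 1 x ≤ dd S 1 (y * x) + dd S 1 (y * x) + 2 * δ := by
    rcases f4 with f | f <;> linarith [dd_nonneg S 1 (y * (y * x))]
  have g5 : dd S 1 (y * x) + dd S 1 (y * x) ≤ dd S 1 (y * (y * x)) + dd S 1 x + 2 * δ := by
    rcases f5 with f | f <;> linarith
  rcases f3 with f | f <;> linarith

lemma exists_pow_len_gt {S : Set Γ} (hS : IsGenSet S) (g : Γ) (hg : ¬ IsOfFinOrder g) (R : ℝ) :
    ∃ K : ℕ, R < len S (g ^ K) := by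
  by_contra! h
  have hinj : Function.Injective (fun n : ℕ => g ^ n) := injective_pow_iff_not_isOfFinOrder.2 hg
  exact Set.infinite_of_injective_forall_mem hinj (s := {x | len S x ≤ R}) h (ballR_finite hS R)

theorem lox_of_infinite {S : Set Γ} {δ : ℝ} (hS : IsGenSet S) (hδ : IsHyperbolic S δ)
    (g : Γ) (hg : ¬ IsOfFinOrder g) : Lox S g := by
  by_contra hl
  have hδ0 := hδ.1
  have hfin := ballR_finite hS (18 * δ + 1)
  set N := hfin.toFinset.card with hN
  set D : ℝ := ∑ r ∈ Finset.range (N + 2), len S (g ^ r) with hD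
  have hDr : ∀ r < N + 2, len S (g ^ r) ≤ D := fun r hr =>
    Finset.single_le_sum (f := fun r => len S (g ^ r)) (fun i _ => len_nonneg S _)
      (Finset.mem_range.2 hr)
  obtain ⟨K, hK⟩ := exists_pow_len_gt hS g hg (2 * (3 * D + 50 * δ + 50) + 2)
  obtain ⟨x, hx1, hx2⟩ := exists_split hS (g ^ K) (wl S (g ^ K) / 2) (Nat.div_le_self _ _)
  have hx1' : 2 * len S x ≥ len S (g ^ K) - 1 := by
    have : wl S (g ^ K) ≤ 2 * wl S x + 1 := by omega
    have : (wl S (g ^ K) : ℝ) ≤ 2 * wl S x + 1 := by exact_mod_cast this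
    unfold len; linarith
  have hx2' : 2 * dd S x (g ^ K) ≥ len S (g ^ K) := by
    have : wl S (g ^ K) ≤ 2 * wl S (x⁻¹ * g ^ K) := by omega
    have : (wl S (g ^ K) : ℝ) ≤ 2 * wl S (x⁻¹ * g ^ K) := by exact_mod_cast this
    rw [dd_eq]; unfold len; linarith
  have hx3 : len S x + dd S x (g ^ K) = len S (g ^ K) := by
    have : wl S x + wl S (x⁻¹ * g ^ K) = wl S (g ^ K) := by omega
    rw [dd_eq]; unfold len; exact_mod_cast this
  have main : ∀ k : ℕ, k < N + 1 → x⁻¹ * g ^ (k + 1) * x ∈ hfin.toFinset := by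
    intro k hk
    have h := shift_dichotomy hS hδ (g ^ (k + 1)) (g ^ K) x D hx3 (hDr _ (by omega))
      (by rw [← pow_add, add_comm, dd_pow]; exact hDr _ (by omega)) (by linarith) (by linarith)
    rcases h with h | h
    · simpa using h
    · exact absurd (lox_pow hS g (k + 1) (by omega)
        (lox_conj hS x _ (lox_of_crit hS hδ _ h))) hl
  have hcard := Finset.card_le_card_of_injOn (s := Finset.range (N + 1)) (t := hfin.toFinset)
    (fun k => x⁻¹ * g ^ (k + 1) * x) (fun k hk => main k (Finset.mem_range.1 hk)) (by
      intro i _ j _ hij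
      have hij' : x⁻¹ * g ^ (i + 1) * x = x⁻¹ * g ^ (j + 1) * x := hij
      have : g ^ (i + 1) = g ^ (j + 1) := by simpa using hij'
      have := (injective_pow_iff_not_isOfFinOrder.2 hg) this
      omega)
  simp only [Finset.card_range] at hcard
  omega

/-! ### Gromov products and sequences -/

lemma gp_comm {S : Set Γ} (hS : IsGenSet S) (x y : Γ) : gp S 1 x y = gp S 1 y x := by
  rw [gp_eq hS, gp_eq hS, dd_comm hS x y]; ring

lemma gp_self {S : Set Γ} (hS : IsGenSet S) (x : Γ) : gp S 1 x x = len S x := by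
  rw [gp_eq hS, dd_self]; ring

lemma gp_le_left {S : Set Γ} (hS : IsGenSet S) (x y : Γ) : gp S 1 x y ≤ len S x := by
  rw [gp_eq hS]
  have := dd_tri hS 1 x y
  rw [dd_one_left, dd_one_left] at this
  linarith

lemma gp_le_right {S : Set Γ} (hS : IsGenSet S) (x y : Γ) : gp S 1 x y ≤ len S y := by
  rw [gp_comm hS]; exact gp_le_left hS y x

lemma gp_hyp {S : Set Γ} {δ : ℝ} (hδ : IsHyperbolic S δ) (x y z : Γ) (T : ℝ)
    (h1 : T ≤ gp S 1 x z) (h2 : T ≤ gp S 1 y z) : T - δ ≤ gp S 1 x y := by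
  have := hδ.2 x y z
  have := le_min h1 h2
  linarith

lemma gp_lip {S : Set Γ} (hS : IsGenSet S) (x y y' : Γ) :
    gp S 1 x y ≤ gp S 1 x y' + dd S y y' := by
  rw [gp_eq hS, gp_eq hS]
  have h1 := dd_tri hS 1 y' y
  have h2 := dd_tri hS x y y'
  rw [dd_one_left, dd_one_left, dd_comm hS y' y] at h1
  linarith

lemma gp_lip2 {S : Set Γ} (hS : IsGenSet S) (x x' y y' : Γ) :
    gp S 1 x y ≤ gp S 1 x' y' + dd S x x' + dd S y y' := by
  have h1 := gp_lip hS x y y'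
  have h2 := gp_lip hS y' x x'
  rw [gp_comm hS y' x, gp_comm hS y' x'] at h2
  linarith

lemma gp_mul_le {S : Set Γ} (hS : IsGenSet S) (k x y : Γ) :
    gp S 1 x y ≤ gp S 1 (k * x) (k * y) + len S k := by
  rw [gp_eq hS, gp_eq hS, dd_left]
  have h1 := len_mul hS k⁻¹ (k * x)
  have h2 := len_mul hS k⁻¹ (k * y)
  rw [len_inv hS, inv_mul_cancel_left] at h1 h2
  linarith

/-- Change of base point. -/
lemma gp_shift {S : Set Γ} (hS : IsGenSet S) (p x y : Γ) :
    gp S 1 (p * x) (p * y) =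
      gp S 1 x y + len S p - gp S 1 x p⁻¹ - gp S 1 y p⁻¹ := by
  simp only [gp_eq hS, dd_left, len_inv hS]
  rw [dd_comm hS x p⁻¹, dd_comm hS y p⁻¹, dd_eq S p⁻¹ x, dd_eq S p⁻¹ y, inv_inv]
  ring

lemma tendsto_prod_iff' (f : ℕ → ℕ → ℝ) :
    Tendsto (fun p : ℕ × ℕ => f p.1 p.2) atTop atTop ↔
      ∀ T : ℝ, ∃ N : ℕ, ∀ i ≥ N, ∀ j ≥ N, T ≤ f i j := by
  rw [tendsto_atTop]
  refine forall_congr' fun T => ?_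
  rw [eventually_atTop]
  constructor
  · rintro ⟨⟨a, b⟩, h⟩
    exact ⟨max a b, fun i hi j hj => h (i, j) ⟨(le_max_left _ _).trans hi, (le_max_right _ _).trans hj⟩⟩
  · rintro ⟨N, h⟩
    exact ⟨(N, N), fun p hp => h p.1 hp.1 p.2 hp.2⟩

/-- `(u_i|v_j) ≥ T` eventually. -/
def Close (S : Set Γ) (u v : ℕ → Γ) (T : ℝ) : Prop :=
  ∃ N : ℕ, ∀ i ≥ N, ∀ j ≥ N, T ≤ gp S 1 (u i) (v j)

lemma convInf_iff {S : Set Γ} {u : ℕ → Γ} : ConvInf S u ↔ ∀ T, Close S u u T :=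
  tendsto_prod_iff' fun i j => gp S 1 (u i) (u j)

lemma equivSeq_iff {S : Set Γ} {u v : ℕ → Γ} : EquivSeq S u v ↔ ∀ T, Close S u v T :=
  tendsto_prod_iff' fun i j => gp S 1 (u i) (v j)

lemma Close.symm {S : Set Γ} (hS : IsGenSet S) {u v : ℕ → Γ} {T : ℝ} (h : Close S u v T) :
    Close S v u T := by
  obtain ⟨N, h⟩ := h
  exact ⟨N, fun i hi j hj => by rw [gp_comm hS]; exact h j hj i hi⟩

lemma Close.trans {S : Set Γ} {δ : ℝ} (hS : IsGenSet S) (hδ : IsHyperbolic S δ)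
    {u v w : ℕ → Γ} {T : ℝ} (h : Close S u v T) (h' : Close S v w T) : Close S u w (T - δ) := by
  obtain ⟨N, h⟩ := h
  obtain ⟨N', h'⟩ := h'
  refine ⟨max N N', fun i hi j hj => ?_⟩
  refine gp_hyp hδ _ _ (v (max N N')) T (h _ (le_of_max_le_left hi) _ (le_max_left _ _)) ?_
  rw [gp_comm hS]
  exact h' _ (le_max_right _ _) _ (le_of_max_le_right hj)

lemma Close.mono {S : Set Γ} {u v : ℕ → Γ} {T T' : ℝ} (h : Close S u v T) (hT : T' ≤ T) :
    Close S u v T' := by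
  obtain ⟨N, h⟩ := h
  exact ⟨N, fun i hi j hj => hT.trans (h i hi j hj)⟩

lemma Close.mul {S : Set Γ} (hS : IsGenSet S) {u v : ℕ → Γ} {T : ℝ} (h : Close S u v T) (k : Γ) :
    Close S (fun n => k * u n) (fun n => k * v n) (T - len S k) := by
  obtain ⟨N, h⟩ := h
  exact ⟨N, fun i hi j hj => by linarith [h i hi j hj, gp_mul_le hS k (u i) (v j)]⟩

lemma Close.near {S : Set Γ} (hS : IsGenSet S) {u v v' : ℕ → Γ} {T : ℝ} (h : Close S u v T) (D : ℝ)
    (hD : ∀ n, dd S (v n) (v' n) ≤ D) : Close S u v' (T - D) := by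
  obtain ⟨N, h⟩ := h
  exact ⟨N, fun i hi j hj => by linarith [h i hi j hj, gp_lip hS (u i) (v j) (v' j), hD j]⟩

lemma convInf_mul {S : Set Γ} (hS : IsGenSet S) {u : ℕ → Γ} (h : ConvInf S u) (k : Γ) :
    ConvInf S (fun n => k * u n) := by
  rw [convInf_iff] at h ⊢
  intro T
  exact ((h (T + len S k)).mul hS k).mono (by linarith)

lemma convInf_near {S : Set Γ} (hS : IsGenSet S) {u u' : ℕ → Γ} (h : ConvInf S u) (D : ℝ)
    (hD : ∀ n, dd S (u n) (u' n) ≤ D) : ConvInf S u' := by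
  rw [convInf_iff] at h ⊢
  intro T
  exact (((((h (T + 2 * D)).near hS D hD).symm hS).near hS D hD)).mono (by linarith)

lemma cls_near {S : Set Γ} (hS : IsGenSet S) (B : Boundary Γ S) {u u' : ℕ → Γ} (h : ConvInf S u)
    (D : ℝ) (hD : ∀ n, dd S (u n) (u' n) ≤ D) : B.cls u = B.cls u' := by
  rw [B.cls_eq u u' h (convInf_near hS h D hD), equivSeq_iff]
  intro T
  exact ((convInf_iff.1 h (T + D)).near hS D hD).mono (by linarith)

lemma smul_one' {S : Set Γ} (B : Boundary Γ S) (ξ : B.pt) : B.smul 1 ξ = ξ := by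
  obtain ⟨u, hu, rfl⟩ := B.cls_surj ξ
  rw [B.smul_cls _ _ hu]; simp

lemma smul_mul' {S : Set Γ} (hS : IsGenSet S) (B : Boundary Γ S) (g h : Γ) (ξ : B.pt) :
    B.smul (g * h) ξ = B.smul g (B.smul h ξ) := by
  obtain ⟨u, hu, rfl⟩ := B.cls_surj ξ
  rw [B.smul_cls _ _ hu, B.smul_cls _ _ hu, B.smul_cls _ _ (convInf_mul hS hu h)]
  simp [mul_assoc]

lemma not_equiv_bound {S : Set Γ} {δ : ℝ} (hS : IsGenSet S) (hδ : IsHyperbolic S δ)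
    (B : Boundary Γ S) {u v : ℕ → Γ} (hu : ConvInf S u) (hv : ConvInf S v)
    (hne : B.cls u ≠ B.cls v) :
    ∃ M : ℝ, ∃ N : ℕ, ∀ i ≥ N, ∀ j ≥ N, gp S 1 (u i) (v j) ≤ M := by
  rw [Ne, B.cls_eq u v hu hv, equivSeq_iff] at hne
  push Not at hne
  obtain ⟨T, hT⟩ := hne
  unfold Close at hT
  push Not at hT
  obtain ⟨N1, h1⟩ := convInf_iff.1 hu (T + 2 * δ)
  obtain ⟨N2, h2⟩ := convInf_iff.1 hv (T + 2 * δ)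
  refine ⟨T + 2 * δ, max N1 N2, fun i hi j hj => ?_⟩
  by_contra! hlt
  obtain ⟨i', hi', j', hj', hh⟩ := hT (max N1 N2)
  have a1 := gp_hyp hδ (u i') (v j) (u i) (T + 2 * δ)
    (h1 _ (le_of_max_le_left hi') _ (le_of_max_le_left hi)) (by rw [gp_comm hS]; exact hlt.le)
  have a2 := gp_hyp hδ (u i') (v j') (v j) (T + 2 * δ - δ) a1 (by
    have := h2 _ (le_of_max_le_right hj') _ (le_of_max_le_right hj)
    linarith [hδ.1])
  linarith

/-! ### Powers of loxodromic elements -/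

lemma Lox.inv {S : Set Γ} (hS : IsGenSet S) {g : Γ} (h : Lox S g) : Lox S g⁻¹ := by
  obtain ⟨a, ha, E, h1, h2⟩ := h
  refine ⟨a, ha, E, ?_, ?_⟩ <;> simpa only [inv_pow, len_inv hS]

lemma Lox.large {S : Set Γ} {g : Γ} (h : Lox S g) (T : ℝ) : ∃ N : ℕ, ∀ m ≥ N, T ≤ len S (g ^ m) := by
  obtain ⟨a, ha, E, h1, h2⟩ := h
  obtain ⟨N, hN⟩ := exists_nat_ge ((T + E) / a)
  refine ⟨N, fun m hm => ?_⟩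
  have h3 : (T + E) / a ≤ m := hN.trans (by exact_mod_cast hm)
  rw [div_le_iff₀ ha] at h3
  linarith [h1 m]

lemma lox_gp {S : Set Γ} (hS : IsGenSet S) {g : Γ} {E : ℝ}
    (h2 : ∀ i j : ℕ, len S (g ^ i) + len S (g ^ j) ≤ len S (g ^ (i + j)) + E)
    (i j : ℕ) (hij : i ≤ j) : len S (g ^ i) - E / 2 ≤ gp S 1 (g ^ i) (g ^ j) := by
  obtain ⟨k, rfl⟩ := Nat.exists_eq_add_of_le hij
  rw [gp_eq hS, dd_pow]
  linarith [h2 i k]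

lemma lox_convInf {S : Set Γ} (hS : IsGenSet S) {g : Γ} (h : Lox S g) :
    ConvInf S (fun n => g ^ n) := by
  rw [convInf_iff]
  intro T
  have h' := h
  obtain ⟨a, ha, E, h1, h2⟩ := h'
  obtain ⟨N, hN⟩ := h.large (T + E / 2)
  refine ⟨N, fun i hi j hj => ?_⟩
  rcases le_total i j with hij | hij
  · linarith [lox_gp hS h2 i j hij, hN i hi]
  · rw [gp_comm hS]; linarith [lox_gp hS h2 j i hij, hN j hj]

lemma lox_plus_ne_minus {S : Set Γ} (hS : IsGenSet S) (B : Boundary Γ S) {g : Γ} (h : Lox S g) :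
    plusPt B g ≠ minusPt B g := by
  unfold plusPt minusPt
  rw [Ne, B.cls_eq _ _ (lox_convInf hS h) (lox_convInf hS (h.inv hS)), equivSeq_iff]
  intro H
  obtain ⟨a, ha, E, h1, h2⟩ := h
  obtain ⟨N, hN⟩ := H (E / 2 + 1)
  have : E / 2 + 1 ≤ gp S 1 (g ^ N) (g⁻¹ ^ N) := hN N le_rfl N le_rfl
  rw [gp_comm hS, gp_eq hS, dd_eq, inv_pow, len_inv hS, inv_inv, ← pow_add] at this
  linarith [h2 N N]

lemma smul_plus {S : Set Γ} (hS : IsGenSet S) (B : Boundary Γ S) {g : Γ} (h : Lox S g) :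
    B.smul g (plusPt B g) = plusPt B g := by
  unfold plusPt
  rw [B.smul_cls _ _ (lox_convInf hS h)]
  symm
  refine cls_near hS B (lox_convInf hS h) (len S g) fun n => ?_
  rw [dd_eq, ← pow_succ', pow_succ, inv_mul_cancel_left]

lemma smul_pow_plus {S : Set Γ} (hS : IsGenSet S) (B : Boundary Γ S) {g : Γ} (h : Lox S g) (n : ℕ) :
    B.smul (g ^ n) (plusPt B g) = plusPt B g := by
  induction n with
  | zero => simpa using smul_one' B _
  | succ n ih => rw [pow_succ, smul_mul' hS, smul_plus hS B h, ih]

lemma minus_conj {S : Set Γ} (hS : IsGenSet S) (B : Boundary Γ S) {g : Γ} (h : Lox S g) (k : Γ) :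
    minusPt B (k * g * k⁻¹) = B.smul k (minusPt B g) := by
  unfold minusPt
  rw [B.smul_cls _ _ (lox_convInf hS (h.inv hS))]
  symm
  refine cls_near hS B (convInf_mul hS (lox_convInf hS (h.inv hS)) k) (len S k) fun n => ?_
  rw [dd_eq, show (k * g * k⁻¹)⁻¹ = k * g⁻¹ * k⁻¹ by group, conj_pow, ← len_inv hS k]
  apply le_of_eq; congr 1; group

/-- Points of the boundary different from `g⁻` have bounded product with the `g⁻ⁱ`. -/
lemma away {S : Set Γ} {δ : ℝ} (hS : IsGenSet S) (hδ : IsHyperbolic S δ)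
    (B : Boundary Γ S) {g : Γ} (h : Lox S g) {u : ℕ → Γ} (hu : ConvInf S u)
    (hne : B.cls u ≠ minusPt B g) :
    ∃ M : ℝ, ∃ N : ℕ, ∀ j ≥ N, ∀ i : ℕ, gp S 1 (u j) (g⁻¹ ^ i) ≤ M := by
  obtain ⟨M, N, H⟩ := not_equiv_bound hS hδ B hu (lox_convInf hS (h.inv hS)) hne
  refine ⟨|M| + N * len S g, N, fun j hj i => ?_⟩
  have hg := len_nonneg S g
  have : 0 ≤ N * len S g := by positivity
  rcases le_total N i with hi | hi
  · linarith [H j hj i hi, le_abs_self M]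
  · have h1 := gp_le_right hS (u j) (g⁻¹ ^ i)
    have h2 := len_pow_le hS g⁻¹ i
    rw [len_inv hS] at h2
    have h3 : (i : ℝ) * len S g ≤ N * len S g :=
      mul_le_mul_of_nonneg_right (by exact_mod_cast hi) hg
    linarith [abs_nonneg M]

/-! ### Some element moves `g⁺` -/

lemma near_of_fix {S : Set Γ} {δ : ℝ} (hS : IsGenSet S) (hδ : IsHyperbolic S δ)
    {g : Γ} (h : Lox S g) {E : ℝ}
    (h2 : ∀ i j : ℕ, len S (g ^ i) + len S (g ^ j) ≤ len S (g ^ (i + j)) + E) (s : Γ)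
    (hs : EquivSeq S (fun n => s * g ^ n) (fun n => g ^ n)) :
    ∃ M0 : ℕ, ∀ M ≥ M0, ∃ n : ℕ, dd S (g ^ M) (s * g ^ n) ≤ len S g + E + 6 * δ := by
  have hδ0 := hδ.1
  have q_step : ∀ i, len S (s * g ^ (i + 1)) ≤ len S (s * g ^ i) + len S g := by
    intro i
    have := len_mul hS (s * g ^ i) g
    rwa [mul_assoc, ← pow_succ] at this
  have q_low : ∀ i, len S (g ^ i) ≤ len S (s * g ^ i) + len S s := by
    intro i
    have := len_mul hS s⁻¹ (s * g ^ i)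
    rw [len_inv hS, inv_mul_cancel_left] at this
    linarith
  obtain ⟨i0, hi0⟩ := h.large (len S s + 2 * δ + E + 1)
  have q_gp : ∀ i ≥ i0, ∀ n ≥ i,
      len S (s * g ^ i) - δ - E / 2 ≤ gp S 1 (s * g ^ i) (s * g ^ n) := by
    intro i hi n hn
    obtain ⟨k, rfl⟩ := Nat.exists_eq_add_of_le hn
    have e1 : dd S s (s * g ^ i) = len S (g ^ i) := by
      simpa [dd_one_left] using dd_left S s 1 (g ^ i)
    have e2 : dd S s (s * g ^ (i + k)) = len S (g ^ (i + k)) := by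
      simpa [dd_one_left] using dd_left S s 1 (g ^ (i + k))
    have f := four hS hδ s (s * g ^ (i + k)) 1 (s * g ^ i)
    rw [gp_eq hS, dd_left, dd_pow]
    rw [dd_comm hS (s * g ^ (i + k)) (s * g ^ i), e1, e2, dd_left, dd_pow, dd_one_left,
      dd_one_right hS, dd_one_right hS] at f
    have := h2 i k
    have := hi0 i hi
    have := len_nonneg S (s * g ^ i)
    rcases f with f | f <;> linarith
  obtain ⟨M0, hM0⟩ := h.large (len S (s * g ^ i0) + 1)
  refine ⟨M0, fun M hM => ?_⟩
  have hMl := hM0 M hM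
  have hex : ∃ i, i0 ≤ i ∧ len S (g ^ M) ≤ len S (s * g ^ i) := by
    obtain ⟨N, hN⟩ := h.large (len S (g ^ M) + len S s)
    refine ⟨max i0 N, le_max_left _ _, ?_⟩
    linarith [hN _ (le_max_right i0 N), q_low (max i0 N)]
  classical
  obtain ⟨hi1, hi2⟩ := Nat.find_spec hex
  set i := Nat.find hex with hi
  have hi3 : len S (s * g ^ i) ≤ len S (g ^ M) + len S g := by
    rcases Nat.eq_or_lt_of_le hi1 with e | e
    · rw [← e] at hi2; linarith
    · have := Nat.find_min hex (m := i - 1) (by omega)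
      push Not at this
      have h4 := this (by omega)
      have h5 := q_step (i - 1)
      rw [show i - 1 + 1 = i by omega] at h5
      linarith
  obtain ⟨N, hN⟩ := equivSeq_iff.1 hs (len S (g ^ M))
  set m := max N (max i M)
  have hmN : N ≤ m := le_max_left _ _
  have hmi : i ≤ m := (le_max_left _ _).trans (le_max_right _ _)
  have hmM : M ≤ m := (le_max_right _ _).trans (le_max_right _ _)
  have c1 := q_gp i hi1 m hmi
  have c2 := hN m hmN m hmN
  have c3 := lox_gp hS h2 M m hmM
  have hE : 0 ≤ E := by
    have := h2 0 0
    simp [len_one] at this; linarith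
  have d1 := gp_hyp hδ (s * g ^ i) (g ^ m) (s * g ^ m) (len S (g ^ M) - δ - E / 2)
    (by linarith) (by rw [gp_comm hS]; linarith)
  have d2 := gp_hyp hδ (g ^ M) (s * g ^ i) (g ^ m) (len S (g ^ M) - δ - E / 2 - δ)
    (by linarith) d1
  refine ⟨i, ?_⟩
  rw [gp_eq hS] at d2
  linarith

lemma exists_move {S : Set Γ} {δ : ℝ} (hS : IsGenSet S) (hδ : IsHyperbolic S δ)
    (hne : Nonelementary Γ) (B : Boundary Γ S) {g : Γ} (h : Lox S g) :
    ∃ s : Γ, B.smul s (plusPt B g) ≠ plusPt B g := by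
  by_contra! H
  have h' := h
  obtain ⟨a, ha, E, h1, h2⟩ := h'
  have hcv := lox_convInf hS h
  have near : ∀ s : Γ, ∃ M0 : ℕ, ∀ M ≥ M0, ∃ n : ℕ,
      dd S (g ^ M) (s * g ^ n) ≤ len S g + E + 6 * δ := by
    intro s
    refine near_of_fix hS hδ h h2 s ?_
    have := H s
    unfold plusPt at this
    rw [B.smul_cls _ _ hcv] at this
    exact (B.cls_eq _ _ (convInf_mul hS hcv s) hcv).1 this
  choose M0 hM0 using near
  have hfin := ballR_finite hS (len S g + E + 6 * δ)
  have hinf : Infinite (Γ ⧸ Subgroup.zpowers g) := by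
    by_contra hc
    rw [not_infinite_iff_finite] at hc
    exact (Subgroup.index_ne_zero_of_finite (H := Subgroup.zpowers g)) (hne g)
  obtain ⟨T, hT⟩ := Infinite.exists_subset_card_eq (Γ ⧸ Subgroup.zpowers g)
    (hfin.toFinset.card + 1)
  set M := T.sup (fun t => M0 t.out) with hM
  have hn : ∀ t : Γ ⧸ Subgroup.zpowers g, t ∈ T → ∃ n : ℕ,
      dd S (g ^ M) (t.out * g ^ n) ≤ len S g + E + 6 * δ :=
    fun t ht => hM0 _ M (Finset.le_sup (f := fun t => M0 t.out) ht)
  choose! n hn using hn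
  have hcard := Finset.card_le_card_of_injOn (s := T) (t := hfin.toFinset)
    (fun t => (g ^ M)⁻¹ * (t.out * g ^ (n t))) (fun t ht => by
      simpa [dd_eq] using hn t ht) (by
      intro t _ t' _ htt
      have e : t.out * g ^ (n t) = t'.out * g ^ (n t') := by simpa using htt
      rw [← t.out_eq', ← t'.out_eq', QuotientGroup.eq]
      have e' : t.out⁻¹ * t'.out = g ^ (n t) * (g ^ (n t'))⁻¹ := by
        rw [inv_mul_eq_iff_eq_mul, ← mul_assoc, e]; group
      rw [e']
      exact mul_mem (pow_mem (Subgroup.mem_zpowers g) _)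
        (inv_mem (pow_mem (Subgroup.mem_zpowers g) _)))
  omega

/-! ### Boundary products and the Hölder condition -/

lemma gp_nonneg {S : Set Γ} (hS : IsGenSet S) (x y : Γ) : 0 ≤ gp S 1 x y := by
  rw [gp_eq hS]
  have := dd_tri hS x 1 y
  rw [dd_one_left, dd_one_right hS] at this
  linarith

lemma le_bgp {S : Set Γ} (B : Boundary Γ S) {u v : ℕ → Γ}
    (hu : ConvInf S u) (hv : ConvInf S v) {r : ℝ} (h : Close S u v r) :
    ENNReal.ofReal r ≤ bgp B (B.cls u) (B.cls v) := by
  unfold bgp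
  refine le_iSup₂_of_le ⟨u, hu, rfl⟩ ⟨v, hv, rfl⟩ ?_
  refine le_liminf_of_le (by isBoundedDefault) ?_
  obtain ⟨N, h⟩ := h
  rw [eventually_atTop]
  exact ⟨(N, N), fun p hp => ENNReal.ofReal_le_ofReal (h p.1 hp.1 p.2 hp.2)⟩

lemma eq_of_bgp_top {S : Set Γ} {δ : ℝ} (hS : IsGenSet S) (hδ : IsHyperbolic S δ)
    (B : Boundary Γ S) {ξ η : B.pt} (h : bgp B ξ η = ⊤) : ξ = η := by
  obtain ⟨u0, hu0, rfl⟩ := B.cls_surj ξ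
  obtain ⟨v0, hv0, rfl⟩ := B.cls_surj η
  rw [B.cls_eq _ _ hu0 hv0, equivSeq_iff]
  intro T
  have hlt : ENNReal.ofReal (T + 2 * δ) < bgp B (B.cls u0) (B.cls v0) := by
    rw [h]; exact ENNReal.ofReal_lt_top
  unfold bgp at hlt
  simp only [lt_iSup_iff] at hlt
  obtain ⟨⟨u, hu, eu⟩, ⟨v, hv, ev⟩, hlt⟩ := hlt
  have hev := eventually_lt_of_lt_liminf hlt (by isBoundedDefault)
  rw [eventually_atTop] at hev
  obtain ⟨⟨a, b⟩, hab⟩ := hev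
  have hc : Close S u v (T + 2 * δ) := by
    refine ⟨max a b, fun i hi j hj => ?_⟩
    have h1 := hab (i, j) ⟨(le_max_left _ _).trans hi, (le_max_right _ _).trans hj⟩
    by_contra! h2
    exact absurd (ENNReal.ofReal_le_ofReal h2.le) (not_le.2 h1)
  have c1 : Close S u0 u (T + 2 * δ) :=
    equivSeq_iff.1 ((B.cls_eq _ _ hu0 hu).1 eu.symm) _
  have c2 : Close S v v0 (T + 2 * δ - δ) :=
    equivSeq_iff.1 ((B.cls_eq _ _ hv hv0).1 ev) _
  exact ((c1.trans hS hδ hc).trans hS hδ c2).mono (by linarith)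

/-- The hypotheses on the cocycle. -/
structure Coc {S : Set Γ} (B : Boundary Γ S) {G : Type} [Group G] [MetricSpace G]
    (τ : ℝ) (c : Γ → B.pt → G) (A : Γ → ℝ) : Prop where
  invL : ∀ a x y : G, dist (a * x) (a * y) = dist x y
  invR : ∀ a x y : G, dist (x * a) (y * a) = dist x y
  pos : 0 < τ
  lt : τ < 1
  Apos : ∀ g : Γ, 0 < A g
  holder : ∀ (g : Γ) (ξ η : B.pt), dist (c g ξ) (c g η) ≤ A g * τ ^ (bgpR B ξ η)
  coc : ∀ (g h : Γ) (ω : B.pt), c (g * h) ω = c g ω * c h (B.smul g⁻¹ ω)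

section

variable {S : Set Γ} {δ : ℝ} {B : Boundary Γ S} {G : Type} [Group G] [MetricSpace G]
  {τ : ℝ} {c : Γ → B.pt → G} {A : Γ → ℝ}

lemma Coc.hol (hS : IsGenSet S) (hδ : IsHyperbolic S δ) (H : Coc B τ c A) (g : Γ) {u v : ℕ → Γ}
    (hu : ConvInf S u) (hv : ConvInf S v) {r : ℝ} (h : Close S u v r) :
    dist (c g (B.cls u)) (c g (B.cls v)) ≤ A g * τ ^ r := by
  have hτ := H.pos
  by_cases he : B.cls u = B.cls v
  · rw [he, dist_self]
    have := H.Apos g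
    positivity
  · have ht : bgp B (B.cls u) (B.cls v) ≠ ⊤ := fun h' => he (eq_of_bgp_top hS hδ B h')
    have h1 : r ≤ bgpR B (B.cls u) (B.cls v) :=
      (ENNReal.ofReal_le_iff_le_toReal ht).1 (le_bgp B hu hv h)
    refine (H.holder g _ _).trans ?_
    exact mul_le_mul_of_nonneg_left
      (Real.rpow_le_rpow_of_exponent_ge H.pos H.lt.le h1) (H.Apos g).le

lemma Coc.dist_mul (H : Coc B τ c A) (a b a' b' : G) :
    dist (a * b) (a' * b') ≤ dist a a' + dist b b' := by
  have := dist_triangle (a * b) (a' * b) (a' * b')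
  rwa [H.invR, H.invL] at this

lemma Coc.one (H : Coc B τ c A) (ω : B.pt) : c 1 ω = 1 := by
  have := H.coc 1 1 ω
  rw [inv_one, smul_one', mul_one] at this
  exact left_eq_mul.1 this

lemma Coc.le_zero (H : Coc B τ c A) {x K T0 : ℝ} (h : ∀ T ≥ T0, x ≤ K * τ ^ T) : x ≤ 0 := by
  have ht : Tendsto (fun T : ℝ => K * τ ^ T) atTop (𝓝 (K * 0)) :=
    (tendsto_rpow_atTop_of_base_lt_one τ (by linarith [H.pos]) H.lt).const_mul K
  rw [mul_zero] at ht
  exact ge_of_tendsto ht ((eventually_ge_atTop T0).mono h)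

/-- Equicontinuity of the `c(g⁻ⁿ,·)` away from `g⁻`. -/
lemma Coc.equicont (hS : IsGenSet S) (hδ : IsHyperbolic S δ) (H : Coc B τ c A) {g : Γ}
    (hg : Lox S g) {u : ℕ → Γ} (hu : ConvInf S u) (hne : B.cls u ≠ minusPt B g) :
    ∃ K T0 : ℝ, ∀ v : ℕ → Γ, ConvInf S v → ∀ T ≥ T0, Close S u v T →
      B.cls v ≠ minusPt B g ∧
      ∀ n : ℕ, dist (c (g⁻¹ ^ n) (B.cls u)) (c (g⁻¹ ^ n) (B.cls v)) ≤ K * τ ^ T := by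
  obtain ⟨M, N, hM⟩ := away hS hδ B hg hu hne
  have hg' := hg
  obtain ⟨a, ha, E, h1, -⟩ := hg'
  have hτ := H.pos
  set q : ℝ := τ ^ a with hq
  have hq0 : 0 < q := Real.rpow_pos_of_pos hτ a
  have hq1 : q < 1 := Real.rpow_lt_one hτ.le H.lt ha
  set K0 : ℝ := A g⁻¹ * τ ^ (-(E + 2 * M + δ)) with hK0
  have hK0pos : 0 < K0 := mul_pos (H.Apos _) (Real.rpow_pos_of_pos hτ _)
  refine ⟨K0 / (1 - q), M + δ + 1, fun v hv T hT hc => ?_⟩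
  obtain ⟨N', hN'⟩ := hc
  have hvb : ∀ j ≥ N', ∀ i : ℕ, gp S 1 (v j) (g⁻¹ ^ i) ≤ M + δ := by
    intro j hj i
    by_contra! hlt
    have k1 := hM (max N N') (le_max_left _ _) i
    have k2 := hN' (max N N') (le_max_right _ _) j hj
    have k3 := hδ.2 (u (max N N')) (g⁻¹ ^ i) (v j)
    rw [gp_comm hS (g⁻¹ ^ i)] at k3
    have k4 : M + δ < min (gp S 1 (u (max N N')) (v j)) (gp S 1 (v j) (g⁻¹ ^ i)) :=
      lt_min (by linarith) hlt
    linarith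
  refine ⟨fun he => ?_, fun n => ?_⟩
  · have := (B.cls_eq _ _ hv (lox_convInf hS (hg.inv hS))).1 he
    obtain ⟨L, hL⟩ := equivSeq_iff.1 this (M + δ + 1)
    have h2 : M + δ + 1 ≤ gp S 1 (v (max L N')) (g⁻¹ ^ L) :=
      hL (max L N') (le_max_left _ _) L le_rfl
    linarith [hvb (max L N') (le_max_right _ _) L]
  · have step : ∀ i : ℕ, dist (c g⁻¹ (B.smul (g ^ i) (B.cls u)))
        (c g⁻¹ (B.smul (g ^ i) (B.cls v))) ≤ K0 * τ ^ T * q ^ i := by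
      intro i
      rw [B.smul_cls _ _ hu, B.smul_cls _ _ hv]
      have hcl : Close S (fun n => g ^ i * u n) (fun n => g ^ i * v n)
          (T + (a * i - E) - M - (M + δ)) := by
        refine ⟨max N N', fun x hx y hy => ?_⟩
        have e := gp_shift hS (g ^ i) (u x) (v y)
        have k1 := hM x (le_of_max_le_left hx) i
        have k2 := hvb y (le_of_max_le_right hy) i
        have k3 := hN' x (le_of_max_le_right hx) y (le_of_max_le_right hy)
        rw [inv_pow] at k1 k2
        linarith [h1 i]
      refine (H.hol hS hδ g⁻¹ (convInf_mul hS hu _) (convInf_mul hS hv _) hcl).trans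
        (le_of_eq ?_)
      rw [hK0, hq, show T + (a * i - E) - M - (M + δ) = -(E + 2 * M + δ) + T + a * i by ring,
        Real.rpow_add hτ, Real.rpow_add hτ, Real.rpow_mul hτ.le, Real.rpow_natCast]
      ring
    have hind : dist (c (g⁻¹ ^ n) (B.cls u)) (c (g⁻¹ ^ n) (B.cls v)) ≤
        K0 / (1 - q) * τ ^ T * (1 - q ^ n) := by
      induction n with
      | zero => simp [H.one]
      | succ n ih =>
        rw [pow_succ g⁻¹, H.coc, H.coc]
        have e : (g⁻¹ ^ n)⁻¹ = g ^ n := by simp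
        rw [e]
        refine (H.dist_mul _ _ _ _).trans ((add_le_add ih (step n)).trans (le_of_eq ?_))
        have : 1 - q ≠ 0 := by linarith
        field_simp
        ring
    refine hind.trans ?_
    have h3 : 0 ≤ K0 / (1 - q) * τ ^ T := by
      have : 0 < 1 - q := by linarith
      positivity
    have h4 : 0 ≤ q ^ n := by positivity
    nlinarith

/-- The elements `h gⁿ` are loxodromic for `n` large, with attracting point close to `h g⁺`. -/
lemma closing (hS : IsGenSet S) (hδ : IsHyperbolic S δ) {g : Γ} (hg : Lox S g) (h : Γ)
    (hne : B.smul h (plusPt B g) ≠ minusPt B g) (T : ℝ) :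
    ∃ n0 : ℕ, ∀ n ≥ n0, ¬ IsOfFinOrder (h * g ^ n) ∧
      Close S (fun l => h * g ^ l) (fun m => (h * g ^ n) ^ m) T := by
  have hcv := lox_convInf hS hg
  have hδ0 := hδ.1
  unfold plusPt at hne
  rw [B.smul_cls _ _ hcv] at hne
  obtain ⟨M, N, hM⟩ := not_equiv_bound hS hδ B (convInf_mul hS hcv h)
    (lox_convInf hS (hg.inv hS)) hne
  have hg' := hg
  obtain ⟨a, ha, E, h1, h2⟩ := hg'
  have hE : 0 ≤ E := by
    have := h2 0 0
    simp [len_one] at this; linarith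
  have hh := len_nonneg S h
  obtain ⟨N1, hN1⟩ := hg.large (2 * |M| + 3 * len S h + 4 * δ + 1 + 2 * (|T| + δ) + E)
  refine ⟨max N N1, fun n hn => ?_⟩
  set f := h * g ^ n with hf
  have hlg := hN1 n (le_of_max_le_right hn)
  have hlf : len S (g ^ n) ≤ len S f + len S h := by
    have := len_mul hS h⁻¹ f
    rw [len_inv hS, hf, inv_mul_cancel_left] at this
    linarith
  have hfM : gp S 1 f f⁻¹ ≤ M + len S h := by
    have k1 : gp S 1 f (g⁻¹ ^ n) ≤ M := hM n (le_of_max_le_left hn) n (le_of_max_le_left hn)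
    have k2 := gp_lip hS f f⁻¹ (g⁻¹ ^ n)
    have k3 : dd S f⁻¹ (g⁻¹ ^ n) = len S h := by
      rw [dd_eq, hf]; congr 1; group
    linarith
  have hM' := le_abs_self M
  have hT' := le_abs_self T
  have hM0 := abs_nonneg M
  have hT0 := abs_nonneg T
  have hcrit : len S f + 4 * δ + 1 ≤ len S (f ^ 2) := by
    rw [gp_eq hS, len_inv hS, dd_eq, show f⁻¹ * f⁻¹ = (f ^ 2)⁻¹ by rw [pow_two]; group,
      len_inv hS] at hfM
    linarith
  have C := crit hS hδ f hcrit
  refine ⟨fun hfin => ?_, max 1 n, fun l hl m hm => ?_⟩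
  · obtain ⟨m, hm, hm1⟩ := isOfFinOrder_iff_pow_eq_one.1 hfin
    have := C (m - 1)
    rw [show m - 1 + 1 = m by omega, hm1, len_one] at this
    linarith [len_nonneg S (f ^ (m - 1))]
  · obtain ⟨m, rfl⟩ := Nat.exists_eq_add_of_le (le_of_max_le_left hm)
    have k1 : |T| + δ ≤ gp S 1 (f ^ (1 + m)) f := by
      have e := dd_pow S f 1 m
      rw [pow_one] at e
      rw [gp_comm hS, gp_eq hS, e, add_comm 1 m]
      linarith [C m]
    have k2 : |T| + δ ≤ gp S 1 (h * g ^ l) f := by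
      have e1 := lox_gp hS h2 n l (le_of_max_le_right hl)
      have e2 := gp_mul_le hS h (g ^ n) (g ^ l)
      rw [gp_comm hS]
      linarith
    have := gp_hyp hδ _ _ _ _ k2 k1
    linarith

variable {bg : Γ → B.pt → G}

lemma Coc.orbit (hS : IsGenSet S) (hδ : IsHyperbolic S δ) (H : Coc B τ c A)
    (hfix : ∀ g : Γ, ¬ IsOfFinOrder g → c g (plusPt B g) = 1 ∧ c g (minusPt B g) = 1)
    {g : Γ} (hg : Lox S g)
    (hbg : ∀ ξ : B.pt, ξ ≠ minusPt B g →
      Tendsto (fun n : ℕ => c (g⁻¹ ^ n) ξ) atTop (𝓝 (bg g ξ)))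
    (h : Γ) (hne : B.smul h (plusPt B g) ≠ minusPt B g) :
    bg g (B.smul h (plusPt B g)) = c h (B.smul h (plusPt B g)) := by
  have hcv := lox_convInf hS hg
  have hu := convInf_mul hS hcv h
  have eω : B.smul h (plusPt B g) = B.cls (fun l => h * g ^ l) := B.smul_cls _ _ hcv
  obtain ⟨K, T0, hK⟩ := H.equicont hS hδ hg hu (eω ▸ hne)
  rw [← dist_le_zero]
  refine H.le_zero (K := K + A h) (T0 := T0) fun T hT => ?_
  obtain ⟨n0, hn0⟩ := closing hS hδ hg h hne T
  have ht : Tendsto (fun n : ℕ => dist (c (g⁻¹ ^ n) (B.smul h (plusPt B g)))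
      (c h (B.smul h (plusPt B g)))) atTop
      (𝓝 (dist (bg g (B.smul h (plusPt B g))) (c h (B.smul h (plusPt B g))))) :=
    (hbg _ hne).dist tendsto_const_nhds
  refine le_of_tendsto ht ((eventually_ge_atTop n0).mono fun n hn => ?_)
  obtain ⟨hf, hcl⟩ := hn0 n hn
  have hfl := lox_of_infinite hS hδ _ hf
  have hfc := lox_convInf hS hfl
  have k1 := (hK _ hfc T hT hcl).2 n
  have k2 := H.hol hS hδ h hfc hu (hcl.symm hS)
  have e : c (g⁻¹ ^ n) (plusPt B (h * g ^ n)) = c h (plusPt B (h * g ^ n)) := by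
    have e1 := H.coc (h * g ^ n) (g⁻¹ ^ n) (plusPt B (h * g ^ n))
    have e2 : B.smul (h * g ^ n)⁻¹ (plusPt B (h * g ^ n)) = plusPt B (h * g ^ n) := by
      conv_lhs => rw [← smul_plus hS B hfl]
      rw [← smul_mul' hS, inv_mul_cancel, smul_one']
    rw [e2, (hfix _ hf).1, one_mul, inv_pow, mul_inv_cancel_right] at e1
    rw [e1, inv_pow]
  unfold plusPt at e
  rw [eω]
  rw [e] at k1
  refine (dist_triangle _ _ _).trans ((add_le_add k1 k2).trans (le_of_eq ?_))
  ring

lemma dense_orbit (hS : IsGenSet S) (hδ : IsHyperbolic S δ) (hne : Nonelementary Γ)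
    (B : Boundary Γ S) {g : Γ} (hg : Lox S g) {u : ℕ → Γ} (hu : ConvInf S u) (T : ℝ) :
    ∃ p : Γ, Close S u (fun m => p * g ^ m) T := by
  have hcv := lox_convInf hS hg
  obtain ⟨s, hs⟩ := exists_move hS hδ hne B hg
  unfold plusPt at hs
  rw [B.smul_cls _ _ hcv] at hs
  obtain ⟨M, N, hM⟩ := not_equiv_bound hS hδ B (convInf_mul hS hcv s) hcv hs
  obtain ⟨J, hJ⟩ := convInf_iff.1 hu (|T| + δ + |M| + δ)
  have hT' := le_abs_self T
  have hM' := le_abs_self M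
  have hM0 := abs_nonneg M
  have hT0 := abs_nonneg T
  have hδ0 := hδ.1
  set x := u J with hx
  have hxl : |T| + δ + |M| + δ ≤ len S x := by
    have := hJ J le_rfl J le_rfl
    rwa [gp_self hS] at this
  have back : ∀ y : Γ, gp S 1 x⁻¹ y ≤ M + δ → |T| + δ ≤ gp S 1 (x * y) x := by
    intro y hy
    have e : gp S 1 (x * y) x = len S x - gp S 1 x⁻¹ y := by
      rw [gp_eq hS, gp_eq hS, len_inv hS, dd_eq S x⁻¹, inv_inv]
      have : dd S (x * y) x = len S y := by
        rw [dd_comm hS, dd_eq, inv_mul_cancel_left]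
      rw [this]; ring
    rw [e]; linarith
  have fin : ∀ p : Γ, (∀ m ≥ N, |T| + δ ≤ gp S 1 (p * g ^ m) x) →
      Close S u (fun m => p * g ^ m) T := by
    intro p hp
    refine ⟨max J N, fun i hi m hm => ?_⟩
    have := gp_hyp hδ (u i) (p * g ^ m) x (|T| + δ)
      (by have := hJ i (le_of_max_le_left hi) J le_rfl; linarith)
      (hp m (le_of_max_le_right hm))
    show T ≤ gp S 1 (u i) (p * g ^ m)
    linarith
  by_cases hc : ∀ m ≥ N, gp S 1 x⁻¹ (g ^ m) ≤ M + δ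
  · exact ⟨x, fin x fun m hm => back _ (hc m hm)⟩
  · push Not at hc
    obtain ⟨m, hm, hlt⟩ := hc
    refine ⟨x * s, fin _ fun l hl => ?_⟩
    rw [mul_assoc]
    refine back _ ?_
    by_contra! hlt2
    have k3 := hδ.2 (s * g ^ l) (g ^ m) x⁻¹
    rw [gp_comm hS _ x⁻¹, gp_comm hS _ x⁻¹] at k3
    have k4 := lt_min hlt2 hlt
    have k5 : gp S 1 (s * g ^ l) (g ^ m) ≤ M := hM l hl m hm
    linarith

/-- Continuity of `b_g` away from `g⁻`. -/
lemma Coc.bg_cont (hS : IsGenSet S) (hδ : IsHyperbolic S δ) (H : Coc B τ c A) {g : Γ}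
    (hg : Lox S g)
    (hbg : ∀ ξ : B.pt, ξ ≠ minusPt B g →
      Tendsto (fun n : ℕ => c (g⁻¹ ^ n) ξ) atTop (𝓝 (bg g ξ)))
    {u : ℕ → Γ} (hu : ConvInf S u) (hne : B.cls u ≠ minusPt B g) :
    ∃ K T0 : ℝ, ∀ v : ℕ → Γ, ConvInf S v → ∀ T ≥ T0, Close S u v T →
      B.cls v ≠ minusPt B g ∧ dist (bg g (B.cls u)) (bg g (B.cls v)) ≤ K * τ ^ T := by
  obtain ⟨K, T0, hK⟩ := H.equicont hS hδ hg hu hne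
  refine ⟨K, T0, fun v hv T hT hc => ?_⟩
  obtain ⟨h1, h2⟩ := hK v hv T hT hc
  exact ⟨h1, le_of_tendsto ((hbg _ hne).dist (hbg _ h1)) (Eventually.of_forall h2)⟩

/-- `c` is the coboundary of `b_g`. -/
lemma Coc.cobound (hS : IsGenSet S) (hδ : IsHyperbolic S δ) (hnel : Nonelementary Γ)
    (H : Coc B τ c A)
    (hfix : ∀ g : Γ, ¬ IsOfFinOrder g → c g (plusPt B g) = 1 ∧ c g (minusPt B g) = 1)
    {g : Γ} (hg : Lox S g)
    (hbg : ∀ ξ : B.pt, ξ ≠ minusPt B g →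
      Tendsto (fun n : ℕ => c (g⁻¹ ^ n) ξ) atTop (𝓝 (bg g ξ)))
    (k : Γ) (ξ : B.pt) (hξ : ξ ≠ minusPt B g) (hξ' : B.smul k⁻¹ ξ ≠ minusPt B g) :
    c k ξ * bg g (B.smul k⁻¹ ξ) = bg g ξ := by
  obtain ⟨u, hu, rfl⟩ := B.cls_surj ξ
  have hcv := lox_convInf hS hg
  have hku := convInf_mul hS hu k⁻¹
  rw [B.smul_cls _ _ hu] at hξ' ⊢
  obtain ⟨K, T0, hK⟩ := H.bg_cont hS hδ hg hbg hu hξ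
  obtain ⟨K', T0', hK'⟩ := H.bg_cont hS hδ hg hbg hku hξ'
  rw [← dist_le_zero]
  refine H.le_zero (K := A k + K' + K)
    (T0 := max T0 T0') fun T hT => ?_
  have hk := len_nonneg S k
  obtain ⟨p, hp⟩ := dense_orbit hS hδ hnel B hg hu (T + len S k)
  have hp1 : Close S u (fun m => p * g ^ m) T := hp.mono (by linarith)
  have hp2 : Close S (fun n => k⁻¹ * u n) (fun m => k⁻¹ * p * g ^ m) T := by
    have := (hp.mul hS k⁻¹).mono (T' := T) (by rw [len_inv hS]; linarith)
    simpa only [mul_assoc] using this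
  have hv := convInf_mul hS hcv p
  have hv' := convInf_mul hS hcv (k⁻¹ * p)
  obtain ⟨n1, d1⟩ := hK _ hv T (le_of_max_le_left hT) hp1
  obtain ⟨n2, d2⟩ := hK' _ hv' T (le_of_max_le_right hT) hp2
  have d3 := H.hol hS hδ k hu hv hp1
  have s1 : B.cls (fun m => p * g ^ m) = B.smul p (plusPt B g) := (B.smul_cls _ _ hcv).symm
  have s2 : B.cls (fun m => k⁻¹ * p * g ^ m) = B.smul (k⁻¹ * p) (plusPt B g) :=
    (B.smul_cls _ _ hcv).symm
  have e : c k (B.cls (fun m => p * g ^ m)) * bg g (B.cls (fun m => k⁻¹ * p * g ^ m)) =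
      bg g (B.cls (fun m => p * g ^ m)) := by
    rw [s1] at n1 ⊢
    rw [s2] at n2 ⊢
    rw [H.orbit hS hδ hfix hg hbg _ n1, H.orbit hS hδ hfix hg hbg _ n2]
    have := H.coc k (k⁻¹ * p) (B.smul p (plusPt B g))
    rw [mul_inv_cancel_left, ← smul_mul' hS] at this
    exact this.symm
  have d4 := H.dist_mul (c k (B.cls u)) (bg g (B.cls fun n => k⁻¹ * u n))
    (c k (B.cls (fun m => p * g ^ m))) (bg g (B.cls (fun m => k⁻¹ * p * g ^ m)))
  rw [e] at d4
  rw [dist_comm] at d1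
  have := dist_triangle (c k (B.cls u) * bg g (B.cls fun n => k⁻¹ * u n))
    (bg g (B.cls (fun m => p * g ^ m))) (bg g (B.cls u))
  linarith

lemma Coc.attract (hS : IsGenSet S) (hδ : IsHyperbolic S δ) (H : Coc B τ c A) {g : Γ}
    (hg : Lox S g) (k : Γ) (η : B.pt) (hη : η ≠ minusPt B g) :
    Tendsto (fun n : ℕ => c k (B.smul (g ^ n) η)) atTop (𝓝 (c k (plusPt B g))) := by
  obtain ⟨u, hu, rfl⟩ := B.cls_surj η
  have hcv := lox_convInf hS hg
  obtain ⟨M, N, hM⟩ := away hS hδ B hg hu hη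
  obtain ⟨M', N', hM'⟩ := away hS hδ B hg hcv (lox_plus_ne_minus hS B hg)
  have hlen : Tendsto (fun n : ℕ => len S (g ^ n) - M - M') atTop atTop := by
    rw [tendsto_atTop_atTop]
    intro b
    obtain ⟨L, hL⟩ := hg.large (b + M + M')
    exact ⟨L, fun n hn => by linarith [hL n hn]⟩
  have hz : Tendsto (fun n : ℕ => A k * τ ^ (len S (g ^ n) - M - M')) atTop (𝓝 0) := by
    have := ((tendsto_rpow_atTop_of_base_lt_one τ (by linarith [H.pos]) H.lt).comp hlen).const_mul
      (A k)
    simpa using this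
  rw [tendsto_iff_dist_tendsto_zero]
  refine squeeze_zero (fun _ => dist_nonneg) (fun n => ?_) hz
  have e : plusPt B g = B.cls (fun m => g ^ n * g ^ m) := by
    rw [← B.smul_cls _ _ hcv]; exact (smul_pow_plus hS B hg n).symm
  rw [e, B.smul_cls _ _ hu]
  refine H.hol hS hδ k (convInf_mul hS hu _) (convInf_mul hS hcv _) ?_
  refine ⟨max N N', fun i hi j hj => ?_⟩
  have e := gp_shift hS (g ^ n) (u i) (g ^ j)
  have k1 := hM i (le_of_max_le_left hi) n
  have k2 := hM' j (le_of_max_le_right hj) n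
  rw [inv_pow] at k1 k2
  have := gp_nonneg hS (u i) (g ^ j)
  show len S (g ^ n) - M - M' ≤ gp S 1 (g ^ n * u i) (g ^ n * g ^ j)
  linarith

lemma Coc.conj (hS : IsGenSet S) (hδ : IsHyperbolic S δ) (H : Coc B τ c A) {g : Γ}
    (hg : Lox S g)
    (hbg : ∀ ξ : B.pt, ξ ≠ minusPt B g →
      Tendsto (fun n : ℕ => c (g⁻¹ ^ n) ξ) atTop (𝓝 (bg g ξ)))
    (k : Γ) (ξ : B.pt) (hξ : B.smul k⁻¹ ξ ≠ minusPt B g) :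
    Tendsto (fun n : ℕ => c ((k * g * k⁻¹)⁻¹ ^ n) ξ) atTop
      (𝓝 (c k ξ * bg g (B.smul k⁻¹ ξ) * c k⁻¹ (plusPt B g))) := by
  have e : ∀ n : ℕ, c ((k * g * k⁻¹)⁻¹ ^ n) ξ =
      c k ξ * c (g⁻¹ ^ n) (B.smul k⁻¹ ξ) * c k⁻¹ (B.smul (g ^ n) (B.smul k⁻¹ ξ)) := by
    intro n
    rw [show (k * g * k⁻¹)⁻¹ = k * g⁻¹ * k⁻¹ by group, conj_pow, H.coc, H.coc, ← smul_mul' hS]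
    congr 3
    rw [mul_inv_rev]; simp
  simp only [e]
  have t1 := hbg _ hξ
  have t2 := H.attract hS hδ hg k⁻¹ _ hξ
  rw [tendsto_iff_dist_tendsto_zero] at t1 t2 ⊢
  have t3 := t1.add t2
  rw [add_zero] at t3
  refine squeeze_zero (fun _ => dist_nonneg) (fun n => ?_) t3
  refine (H.dist_mul _ _ _ _).trans ?_
  rw [H.invL]

end

theorem cocycle_limit_properties
    (Γ : Type) [Group Γ] (S : Set Γ) (δ : ℝ)
    (hS : IsGenSet S) (hδ : IsHyperbolic S δ) (hne : Nonelementary Γ)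
    (B : Boundary Γ S)
    (G : Type) [Group G] [MetricSpace G] [CompleteSpace G]
    (hinvL : ∀ a x y : G, dist (a * x) (a * y) = dist x y)
    (hinvR : ∀ a x y : G, dist (x * a) (y * a) = dist x y)
    (τ : ℝ) (hτ0 : 0 < τ) (hτ1 : τ < 1)
    (c : Γ → B.pt → G)
    (A : Γ → ℝ) (hA : ∀ g : Γ, 0 < A g)
    (hHolder : ∀ (g : Γ) (ξ η : B.pt), dist (c g ξ) (c g η) ≤ A g * τ ^ (bgpR B ξ η))
    (hcocycle : ∀ (g h : Γ) (ω : B.pt), c (g * h) ω = c g ω * c h (B.smul g⁻¹ ω))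
    (hfix : ∀ g : Γ, ¬ IsOfFinOrder g → c g (plusPt B g) = 1 ∧ c g (minusPt B g) = 1)
    (bg : Γ → B.pt → G)
    (hbg : ∀ g' : Γ, ¬ IsOfFinOrder g' → ∀ ξ : B.pt, ξ ≠ minusPt B g' →
      Tendsto (fun n : ℕ => c (g'⁻¹ ^ n) ξ) atTop (𝓝 (bg g' ξ)))
    (g : Γ) (hg : ¬ IsOfFinOrder g) :
    (∀ h : Γ, B.smul h (plusPt B g) ≠ minusPt B g →
      bg g (B.smul h (plusPt B g)) = (c h⁻¹ (plusPt B g))⁻¹) ∧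
    (∀ (k : Γ) (ξ : B.pt), ξ ≠ minusPt B g → ξ ≠ B.smul k (minusPt B g) →
      bg g ξ = bg (k * g * k⁻¹) ξ * (c k⁻¹ (plusPt B g))⁻¹) := by
  have H : Coc B τ c A := ⟨hinvL, hinvR, hτ0, hτ1, hA, hHolder, hcocycle⟩
  have hl := lox_of_infinite hS hδ g hg
  refine ⟨fun h hne' => ?_, fun k ξ h1 h2 => ?_⟩
  · rw [H.orbit hS hδ hfix hl (hbg g hg) h hne', eq_inv_iff_mul_eq_one, mul_eq_one_iff_inv_eq',
      inv_eq_iff_mul_eq_one]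
    have := H.coc h⁻¹ h (plusPt B g)
    rw [inv_mul_cancel, H.one, inv_inv] at this
    exact this.symm
  · have h3 : B.smul k⁻¹ ξ ≠ minusPt B g := by
      intro he
      apply h2
      rw [← he, ← smul_mul' hS, mul_inv_cancel, smul_one']
    have hk : ¬ IsOfFinOrder (k * g * k⁻¹) := by
      intro hf
      apply hg
      obtain ⟨m, hm, hm1⟩ := isOfFinOrder_iff_pow_eq_one.1 hf
      rw [conj_pow, mul_inv_eq_one, mul_eq_left] at hm1
      exact isOfFinOrder_iff_pow_eq_one.2 ⟨m, hm, hm1⟩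
    have e := tendsto_nhds_unique (hbg _ hk ξ (by rw [minus_conj hS B hl]; exact h2))
      (H.conj hS hδ hl (hbg g hg) k ξ h3)
    rw [e, H.cobound hS hδ hne hfix hl (hbg g hg) k ξ h1 h3, mul_inv_cancel_right]

end HarmonicBoundary
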